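/- arXiv:0902.1744 — 2 statements merged into one kernel-verified Lean document; each statement's English description precedes it below -/
import Mathlib

section
/- For all integers λ1, λ2, β1, β2 with λ1 ≥ 0, λ2 ≥ 0, β1 ≥ 0, λ2 − β2 ≥ 0, −β1 + β2 ≥ 0 and λ1 − β1 ≥ 0, one has N(λ1, λ2, β1, β2) = (1/8)(−1)^{β1} + β1 + (1/4)β1² + 7/8. -/
/-- The number of quadruples `(a22, a11, a12, a13)` of nonnegative integers satisfying
Littelmann's inequalities for `so₅(ℂ)` together with the weight equations
`a22 + a12 = β1` and `a11 + a13 = β2`.  By Littelmann's results this is the dimension of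
the weight space of weight `λ1·ω1 + λ2·ω2 − β1·α1 − β2·α2` in the irreducible
`so₅(ℂ)`-module of highest weight `λ1·ω1 + λ2·ω2`. -/
noncomputable def weightMult (l1 l2 b1 b2 : ℤ) : ℕ :=
  Set.ncard {a : ℤ × ℤ × ℤ × ℤ |
    0 ≤ a.1 ∧ 0 ≤ a.2.1 ∧ 0 ≤ a.2.2.1 ∧ 0 ≤ a.2.2.2 ∧
    2 * a.2.1 ≥ a.2.2.1 ∧
    a.2.2.1 ≥ 2 * a.2.2.2 ∧
    a.2.2.2 ≤ l2 ∧
    a.2.2.1 ≤ l1 + 2 * a.2.2.2 ∧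
    a.2.1 ≤ l2 + a.2.2.1 - 2 * a.2.2.2 ∧
    a.1 ≤ l1 + 2 * a.2.1 - 2 * a.2.2.1 + 2 * a.2.2.2 ∧
    a.1 + a.2.2.1 = b1 ∧
    a.2.1 + a.2.2.2 = b2}

theorem count_formula (n : ℕ) :
    ((∑ y ∈ Finset.range (n + 1), (y / 2 + 1) : ℕ) : ℚ)
      = (1/8)*(-1 : ℚ)^n + n + (1/4)*n^2 + 7/8 := by
  induction n with
  | zero => norm_num
  | succ k ih =>
    rw [Finset.sum_range_succ, Nat.cast_add, ih]
    rcases Nat.even_or_odd' k with ⟨m, rfl | rfl⟩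
    all_goals have e : (-1 : ℚ) ^ (2 * m) = 1 := by rw [pow_mul]; norm_num
    · have h : (2 * m + 1) / 2 = m := by omega
      rw [h, pow_succ (-1 : ℚ) (2 * m), e]
      push_cast
      ring
    · have h : (2 * m + 1 + 1) / 2 = m + 1 := by omega
      rw [h, pow_succ (-1 : ℚ) (2 * m + 1), pow_succ (-1 : ℚ) (2 * m), e]
      push_cast
      ring

theorem weightMult_on_cone_f4 (l1 l2 b1 b2 : ℤ)
    (h0 : 0 ≤ l1)
    (h1 : 0 ≤ l2)
    (h2 : 0 ≤ b1)
    (h3 : 0 ≤ l2 - b2)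
    (h4 : 0 ≤ -b1 + b2)
    (h5 : 0 ≤ l1 - b1) :
    (weightMult l1 l2 b1 b2 : ℚ) = (1/8)*(-1 : ℚ)^b1 + b1 + (1/4)*b1^2 + 7/8 := by
  obtain ⟨n, rfl⟩ := Int.eq_ofNat_of_zero_le h2
  have key : weightMult l1 l2 n b2 = ∑ y ∈ Finset.range (n + 1), (y / 2 + 1) := by
    have hc : ∑ y ∈ Finset.range (n + 1), (y / 2 + 1)
        = ((Finset.range (n + 1)).sigma (fun y => Finset.range (y / 2 + 1))).card := by
      simp [Finset.card_sigma]
    rw [hc, ← Finset.card_image_of_injective _ (f := fun p : (_ : ℕ) × ℕ =>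
      (((n : ℤ) - p.1, b2 - p.2, (p.1 : ℤ), (p.2 : ℤ)) : ℤ × ℤ × ℤ × ℤ)),
      ← Set.ncard_coe_finset]
    · unfold weightMult
      congr 1
      ext ⟨a, b, c, d⟩
      simp only [Set.mem_ofPred_eq, Finset.coe_image, Set.mem_image, Finset.mem_coe,
        Finset.mem_sigma, Finset.mem_range, Prod.mk.injEq]
      constructor
      · rintro ⟨_, _, _, _, _, _, _, _, _, _, _, _⟩
        refine ⟨⟨c.toNat, d.toNat⟩, ⟨?_, ?_⟩, ?_, ?_, ?_, ?_⟩ <;> dsimp only <;> omega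
      · rintro ⟨⟨y, x⟩, ⟨hy, hx⟩, rfl, rfl, rfl, rfl⟩
        dsimp only at *
        refine ⟨?_, ?_, ?_, ?_, ?_, ?_, ?_, ?_, ?_, ?_, ?_, ?_⟩ <;> omega
    · rintro ⟨y, x⟩ ⟨y', x'⟩ h
      simp only [Prod.mk.injEq, Nat.cast_inj] at h
      obtain ⟨_, _, rfl, rfl⟩ := h
      rfl
  rw [key, count_formula]
  simp
end

section
/- For all integers λ1, λ2, β1, β2 with λ1 ≥ 0, λ2 ≥ 0, −λ1 − 2λ2 + β1 ≥ 0, λ1 − β1 + β2 ≥ 0 and β1 − 2β2 ≥ 0, one has N(λ1, λ2, β1, β2) = 1 + β2 + λ1 − β1 + (1/2)λ2² + λ1λ2 + λ2β2 + (3/2)λ2 − λ2β1. -/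
lemma sum_aux (C L : ℕ) :
    ((∑ j ∈ Finset.range (L + 1), (C + j + 1) : ℕ) : ℚ) = (L + 1) * (C + 1) + L * (L + 1) / 2 := by
  induction L with
  | zero => simp
  | succ n ih =>
    rw [Finset.sum_range_succ, Nat.cast_add, ih]
    push_cast
    ring

theorem weightMult_on_cone_f23 (l1 l2 b1 b2 : ℤ)
    (h0 : 0 ≤ l1)
    (h1 : 0 ≤ l2)
    (h2 : 0 ≤ -l1 - 2*l2 + b1)
    (h3 : 0 ≤ l1 - b1 + b2)
    (h4 : 0 ≤ b1 - 2*b2) :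
    (weightMult l1 l2 b1 b2 : ℚ) = 1 + b2 + l1 - b1 + (1/2)*l2^2 + l1*l2 + l2*b2 + (3/2)*l2 - l2*b1 := by
  obtain ⟨L, rfl⟩ := Int.eq_ofNat_of_zero_le h1
  obtain ⟨C, hC⟩ := Int.eq_ofNat_of_zero_le h3
  let F : Finset (Σ _ : ℕ, ℕ) := (Finset.range (L + 1)).sigma fun j => Finset.range (C + j + 1)
  let f : (Σ _ : ℕ, ℕ) → ℤ × ℤ × ℤ × ℤ := fun p =>
    (b1 - (b2 - p.1 + p.2), b2 - (L - p.1), b2 - p.1 + p.2, (L : ℤ) - p.1)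
  have hf : Function.Injective f := by
    rintro ⟨j, i⟩ ⟨j', i'⟩ h
    simp only [f, Prod.mk.injEq] at h
    obtain rfl : j = j' := by omega
    obtain rfl : i = i' := by omega
    rfl
  have hcard : weightMult l1 L b1 b2 = ∑ j ∈ Finset.range (L + 1), (C + j + 1) := by
    have hF : F.card = ∑ j ∈ Finset.range (L + 1), (C + j + 1) := by
      simp [F, Finset.card_sigma]
    rw [← hF, ← Set.ncard_coe_finset F, ← Set.ncard_image_of_injective _ hf]
    unfold weightMult
    congr 1
    ext ⟨a, b, c, d⟩
    simp only [Set.mem_setOf_eq, Set.mem_image, Finset.mem_coe, F, f, Finset.mem_sigma,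
      Finset.mem_range, Prod.mk.injEq, Sigma.exists]
    constructor
    · intro h
      refine ⟨(L - d).toNat, (c - b2 + (L - d)).toNat, ?_⟩
      omega
    · rintro ⟨j, i, h⟩
      omega
  rw [hcard, sum_aux]
  have hC' : (C : ℚ) = l1 - b1 + b2 := by exact_mod_cast hC.symm
  rw [hC']
  push_cast
  ring
end
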